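/- arXiv:1901.04348 — 9 statements merged into one kernel-verified Lean document; each statement's English description precedes it below -/
import Mathlib

section
/- Let Γ be a group, R a set, ω : R → Γ a function, and let (C, ∂) = (F/P, ∂) be the quotient of the free group F on R × Γ by the Peiffer subgroup P, with the induced boundary ∂ and induced Γ-action. Then (C, ∂) is the free crossed Γ-module on ω: for every crossed module ∂' : T' → Γ over Γ and every function σ : R → T' satisfying ∂'(σ(r)) = ω(r) for all r ∈ R, there exists a unique group homomorphism φ : C → T' that is Γ-equivariant (φ(t^g) = φ(t)^g), satisfies ∂'∘φ = ∂, and sends the class of (r, 1) to σ(r) for every r ∈ R. -/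
/-- The Peiffer element `(r,u)⁻¹ (s,v)⁻¹ (r,u) (s, v u⁻¹ ω(r) u)` in the free group on `R × Γ`. -/
def peifferElt {R Γ : Type*} [Group Γ] (ω : R → Γ) (r s : R) (u v : Γ) :
    FreeGroup (R × Γ) :=
  (FreeGroup.of (r, u))⁻¹ * (FreeGroup.of (s, v))⁻¹ * FreeGroup.of (r, u) *
    FreeGroup.of (s, v * u⁻¹ * ω r * u)

/-- The set of all Peiffer elements. -/
def peifferSet {R Γ : Type*} [Group Γ] (ω : R → Γ) : Set (FreeGroup (R × Γ)) :=
  {x | ∃ r s u v, x = peifferElt ω r s u v}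

/-- The right action of `v ∈ Γ` on the free group on `R × Γ`, determined on free generators
by `(r,u)^v = (r, u·v)`. -/
def gammaAct {R Γ : Type*} [Group Γ] (v : Γ) :
    FreeGroup (R × Γ) →* FreeGroup (R × Γ) :=
  FreeGroup.lift fun p => FreeGroup.of (p.1, p.2 * v)

/-- The quotient `C = F/P` of the free group `F` on `R × Γ` by the Peiffer subgroup. -/
abbrev FreeCrossed {R Γ : Type*} [Group Γ] (ω : R → Γ) :=
  FreeGroup (R × Γ) ⧸ Subgroup.normalClosure (peifferSet ω)

/-- A crossed module over `Γ` : a homomorphism `∂ : T →* Γ` together with a right action of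
`Γ` on `T` by group automorphisms, satisfying equivariance and the Peiffer identity. -/
structure IsCrossedModule {T Γ : Type*} [Group T] [Group Γ]
    (bd : T →* Γ) (act : T → Γ → T) : Prop where
  act_one : ∀ t, act t 1 = t
  act_act : ∀ t g h, act t (g * h) = act (act t g) h
  act_mul : ∀ t u g, act (t * u) g = act t g * act u g
  equivariant : ∀ t g, bd (act t g) = g⁻¹ * bd t * g
  peiffer : ∀ t u, act t (bd u) = u⁻¹ * t * u

/-- `(C, ∂) = (F/P, ∂)`, with the induced boundary and induced `Γ`-action, is the free
crossed `Γ`-module on `ω` : for every crossed module `∂' : T' → Γ` and every `σ : R → T'`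
with `∂'(σ r) = ω r`, there is a unique group homomorphism `φ : C → T'` which is
`Γ`-equivariant, satisfies `∂' ∘ φ = ∂`, and sends the class of `(r,1)` to `σ r`. -/
theorem stmt_3 {R Γ : Type*} [Group Γ] (ω : R → Γ)
    (bd : FreeCrossed ω →* Γ)
    (hbd : ∀ p : R × Γ, bd (QuotientGroup.mk (FreeGroup.of p)) = p.2⁻¹ * ω p.1 * p.2)
    (act : FreeCrossed ω → Γ → FreeCrossed ω)
    (hact : ∀ (f : FreeGroup (R × Γ)) (v : Γ),
      act (QuotientGroup.mk f) v = QuotientGroup.mk (gammaAct v f))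
    (hcm : IsCrossedModule bd act) :
    ∀ (T' : Type*) [Group T'] (bd' : T' →* Γ) (act' : T' → Γ → T'),
      IsCrossedModule bd' act' →
      ∀ σ : R → T', (∀ r, bd' (σ r) = ω r) →
      ∃! φ : FreeCrossed ω →* T',
        (∀ (t : FreeCrossed ω) (g : Γ), φ (act t g) = act' (φ t) g) ∧
        (∀ t : FreeCrossed ω, bd' (φ t) = bd t) ∧
        (∀ r : R, φ (QuotientGroup.mk (FreeGroup.of (r, 1))) = σ r) := by
  intro T' _ bd' act' h' σ hσ
  let ah : Γ → (T' →* T') := fun g => MonoidHom.mk' (fun t => act' t g) (fun a b => h'.act_mul a b g)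
  let f : FreeGroup (R × Γ) →* T' := FreeGroup.lift fun p => act' (σ p.1) p.2
  have hf : ∀ p, f (FreeGroup.of p) = act' (σ p.1) p.2 := fun p => FreeGroup.lift_apply_of
  have hker : Subgroup.normalClosure (peifferSet ω) ≤ f.ker := by
    apply Subgroup.normalClosure_le_normal
    rintro x ⟨r, s, u, v, rfl⟩
    have e : act' (σ s) (v * u⁻¹ * ω r * u)
        = (act' (σ r) u)⁻¹ * act' (σ s) v * act' (σ r) u := by
      rw [← h'.peiffer, h'.equivariant, hσ, ← h'.act_act]
      simp only [mul_assoc]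
    show f _ = 1
    simp only [peifferElt, map_mul, map_inv, hf, e]
    group
  let φ : FreeCrossed ω →* T' := QuotientGroup.lift _ f hker
  have hφ : ∀ x, φ (QuotientGroup.mk x) = f x := fun x => rfl
  refine ⟨φ, ⟨?_, ?_, ?_⟩, ?_⟩
  · intro t g
    obtain ⟨x, rfl⟩ := QuotientGroup.mk_surjective t
    rw [hact, hφ, hφ]
    have : f.comp (gammaAct g) = (ah g).comp f := by
      ext p
      show f (gammaAct g (FreeGroup.of p)) = act' (f (FreeGroup.of p)) g
      rw [gammaAct, FreeGroup.lift_apply_of, hf, hf, h'.act_act]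
    exact DFunLike.congr_fun this x
  · intro t
    obtain ⟨x, rfl⟩ := QuotientGroup.mk_surjective t
    have : bd'.comp f = bd.comp (QuotientGroup.mk' _) := by
      ext p
      show bd' (f (FreeGroup.of p)) = bd (QuotientGroup.mk (FreeGroup.of p))
      rw [hf, hbd, h'.equivariant, hσ]
    exact DFunLike.congr_fun this x
  · intro r
    rw [hφ, hf, h'.act_one]
  · rintro ψ ⟨h1, _, h3⟩
    apply QuotientGroup.monoidHom_ext
    ext p
    obtain ⟨r, u⟩ := p
    show ψ (QuotientGroup.mk (FreeGroup.of (r, u))) = f (FreeGroup.of (r, u))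
    have := h1 (QuotientGroup.mk (FreeGroup.of (r, 1))) u
    rw [hact, h3, gammaAct, FreeGroup.lift_apply_of, one_mul] at this
    rw [this, hf]
end

section
/- Let Γ be a group, R a set, ω : R → Γ a function, and let (C, ∂) = (F/P, ∂) be the free crossed Γ-module on ω (the quotient of the free group F on R × Γ by the Peiffer subgroup, with induced boundary ∂ and Γ-action). Let N be the range of ∂ and Q = Γ/N. Then the Γ-action on C descends to an action on the abelianization C^ab on which N acts trivially, so that C^ab becomes a module over the group ring ℤ[Q]; moreover C^ab is a free ℤ[Q]-module with basis the images in C^ab of the classes of the generators (r, 1), r ∈ R. -/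
/-- Let `(C,∂)` be the free crossed `Γ`-module on `ω`, `N = range ∂`, `Q = Γ/N`.
The `Γ`-action descends to an action `ρ` of `Q` on the abelianization `C^ab` (in particular
`N` acts trivially), making `C^ab` a module over `ℤ[Q]`; moreover `C^ab` is a *free*
`ℤ[Q]`-module on the images of the classes of the generators `(r,1)`, expressed by the
universal property: every function from `R` to an abelian group with a `Q`-action extends
uniquely to an additive `Q`-equivariant map on `C^ab`. -/
theorem stmt_5 {R Γ : Type*} [Group Γ] (ω : R → Γ)
    (bd : FreeCrossed ω →* Γ)
    (hbd : ∀ p : R × Γ, bd (QuotientGroup.mk (FreeGroup.of p)) = p.2⁻¹ * ω p.1 * p.2)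
    (act : FreeCrossed ω → Γ → FreeCrossed ω)
    (hact : ∀ (f : FreeGroup (R × Γ)) (v : Γ),
      act (QuotientGroup.mk f) v = QuotientGroup.mk (gammaAct v f))
    (hcm : IsCrossedModule bd act)
    [hN : bd.range.Normal] :
    ∃ ρ : Abelianization (FreeCrossed ω) → (Γ ⧸ bd.range) → Abelianization (FreeCrossed ω),
      (∀ a, ρ a 1 = a) ∧
      (∀ a q q', ρ a (q * q') = ρ (ρ a q) q') ∧
      (∀ a b q, ρ (a * b) q = ρ a q * ρ b q) ∧
      (∀ (c : FreeCrossed ω) (g : Γ),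
        ρ (Abelianization.of c) (QuotientGroup.mk g) = Abelianization.of (act c g)) ∧
      (∀ (M : Type*) [CommGroup M] (actM : M → (Γ ⧸ bd.range) → M),
        (∀ m, actM m 1 = m) →
        (∀ m q q', actM m (q * q') = actM (actM m q) q') →
        (∀ m m' q, actM (m * m') q = actM m q * actM m' q) →
        ∀ f : R → M,
        ∃! φ : Abelianization (FreeCrossed ω) →* M,
          (∀ a q, φ (ρ a q) = actM (φ a) q) ∧
          (∀ r : R, φ (Abelianization.of (QuotientGroup.mk (FreeGroup.of (r, 1)))) = f r)) := by
  classical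
  let α : Γ → FreeCrossed ω →* FreeCrossed ω := fun g =>
    MonoidHom.mk' (fun t => act t g) (fun t u => hcm.act_mul t u g)
  have hα : ∀ g t, α g t = act t g := fun _ _ => rfl
  let A : Γ → Abelianization (FreeCrossed ω) →* Abelianization (FreeCrossed ω) :=
    fun g => Abelianization.map (α g)
  have hA : ∀ g t, A g (Abelianization.of t) = Abelianization.of (act t g) := fun g t => rfl
  have ind : ∀ {p : Abelianization (FreeCrossed ω) → Prop},
      (∀ t, p (Abelianization.of t)) → ∀ a, p a := by
    intro p h a
    obtain ⟨t, rfl⟩ := QuotientGroup.mk_surjective a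
    exact h t
  have hAmul : ∀ g h a, A (g * h) a = A h (A g a) := by
    intro g h a
    induction a using ind with
    | _ t => rw [hA, hA, hA, hcm.act_act]
  have hAone : ∀ a, A 1 a = a := by
    intro a
    induction a using ind with
    | _ t => rw [hA, hcm.act_one]
  have hAbd : ∀ c a, A (bd c) a = a := by
    intro c a
    induction a using ind with
    | _ t =>
      rw [hA, hcm.peiffer, map_mul, map_mul, map_inv, mul_comm, mul_inv_cancel_left]
  let ρ : Abelianization (FreeCrossed ω) → (Γ ⧸ bd.range) → Abelianization (FreeCrossed ω) :=
    fun a q => Quotient.liftOn' q (fun g => A g a) (by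
      intro g h hgh
      rw [QuotientGroup.leftRel_apply] at hgh
      obtain ⟨c, hc⟩ := hgh
      have : h = g * bd c := by rw [hc]; group
      show A g a = A h a
      rw [this, hAmul, hAbd])
  have hρ : ∀ a (g : Γ), ρ a (QuotientGroup.mk g) = A g a := fun _ _ => rfl
  refine ⟨ρ, ?_, ?_, ?_, ?_, ?_⟩
  · intro a
    exact hAone a
  · intro a q q'
    obtain ⟨g, rfl⟩ := QuotientGroup.mk_surjective q
    obtain ⟨h, rfl⟩ := QuotientGroup.mk_surjective q'
    exact hAmul g h a
  · intro a b q
    obtain ⟨g, rfl⟩ := QuotientGroup.mk_surjective q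
    exact map_mul (A g) a b
  · intro c g
    rfl
  · intro M _ actM h1 hmul hadd f
    let β : (Γ ⧸ bd.range) → M →* M := fun q => MonoidHom.mk' (fun m => actM m q)
      (fun m m' => hadd m m' q)
    let φ₀ : FreeGroup (R × Γ) →* M :=
      FreeGroup.lift fun p => actM (f p.1) (QuotientGroup.mk p.2)
    have hφ₀ : ∀ p, φ₀ (FreeGroup.of p) = actM (f p.1) (QuotientGroup.mk p.2) := fun p => by
      simp [φ₀]
    have hker : Subgroup.normalClosure (peifferSet ω) ≤ φ₀.ker := by
      apply Subgroup.normalClosure_le_normal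
      rintro x ⟨r, s, u, v, rfl⟩
      show φ₀ _ = 1
      have hq : (QuotientGroup.mk (v * u⁻¹ * ω r * u) : Γ ⧸ bd.range) = QuotientGroup.mk v := by
        symm
        rw [QuotientGroup.eq]
        refine ⟨QuotientGroup.mk (FreeGroup.of (r, u)), ?_⟩
        rw [hbd]
        simp [mul_assoc]
      rw [peifferElt, map_mul, map_mul, map_mul, map_inv, map_inv, hφ₀, hφ₀, hφ₀]
      simp only [hq]
      rw [mul_right_comm, mul_assoc, mul_assoc]
      simp
    let φ₁ : FreeCrossed ω →* M := QuotientGroup.lift _ φ₀ hker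
    let φ : Abelianization (FreeCrossed ω) →* M := Abelianization.lift φ₁
    have hφ : ∀ x, φ (Abelianization.of (QuotientGroup.mk x)) = φ₀ x := fun x => rfl
    have key : ∀ g x, A g (Abelianization.of (QuotientGroup.mk x)) =
        Abelianization.of (QuotientGroup.mk (gammaAct g x)) := by
      intro g x
      rw [hA, hact]
    refine ⟨φ, ⟨?_, ?_⟩, ?_⟩
    · intro a q
      obtain ⟨g, rfl⟩ := QuotientGroup.mk_surjective q
      induction a using ind with
      | _ t =>
        obtain ⟨x, rfl⟩ := QuotientGroup.mk_surjective t
        rw [hρ, key, hφ, hφ]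
        have : φ₀.comp (gammaAct g) = (β (QuotientGroup.mk g)).comp φ₀ := by
          ext p
          show φ₀ (gammaAct g (FreeGroup.of p)) = actM (φ₀ (FreeGroup.of p)) (QuotientGroup.mk g)
          rw [gammaAct, FreeGroup.lift_apply_of, hφ₀, hφ₀, ← hmul]
          rfl
        exact DFunLike.congr_fun this x
    · intro r
      rw [hφ, hφ₀]
      exact h1 _
    · rintro ψ ⟨hψ, hψf⟩
      refine MonoidHom.ext fun a => ?_
      induction a using ind with
      | _ t =>
        obtain ⟨x, rfl⟩ := QuotientGroup.mk_surjective t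
        have : (ψ.comp Abelianization.of).comp (QuotientGroup.mk' _) = φ₀ := by
          ext p
          obtain ⟨r, u⟩ := p
          have e := hψ (Abelianization.of (QuotientGroup.mk (FreeGroup.of (r, 1))))
            (QuotientGroup.mk u)
          rw [hρ, key, hψf, gammaAct, FreeGroup.lift_apply_of, one_mul] at e
          rw [hφ₀]
          exact e
        exact DFunLike.congr_fun this x
end

section
/- Let G be a semiregular groupoid with vertex monoid V(G) having identity e. Define total binary operations on the set of all morphisms of G by α * β = (α ◁ βd) ∘ (αr ▷ β) and α ⊛ β = (αd ▷ β) ∘ (α ◁ βr), where αd and αr denote the domain and range of α. Then each of * and ⊛ is associative with two-sided identity the identity morphism 1_e; that is, each makes the set of morphisms of G a monoid with identity 1_e. -/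
/-- A semiregular groupoid: a groupoid, presented algebraically with morphism set `M`,
vertex set `V`, domain `d`, range `r`, identities `idm`, (diagrammatic-order) composition
`comp` (constrained only on composable pairs) and inversion `inv`, where `V` is a monoid
acting on `M` on the left (`lact`) and on the right (`ract`), compatibly with the
groupoid structure. -/
structure SemiregularGroupoid (V : Type*) (M : Type*) [Monoid V] where
  d : M → V
  r : M → V
  idm : V → M
  comp : M → M → M
  inv : M → M
  d_idm : ∀ x, d (idm x) = x
  r_idm : ∀ x, r (idm x) = x
  d_comp : ∀ {α β}, r α = d β → d (comp α β) = d α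
  r_comp : ∀ {α β}, r α = d β → r (comp α β) = r β
  comp_assoc : ∀ {α β γ}, r α = d β → r β = d γ →
    comp (comp α β) γ = comp α (comp β γ)
  idm_comp : ∀ α, comp (idm (d α)) α = α
  comp_idm : ∀ α, comp α (idm (r α)) = α
  d_inv : ∀ α, d (inv α) = r α
  r_inv : ∀ α, r (inv α) = d α
  comp_inv : ∀ α, comp α (inv α) = idm (d α)
  inv_comp : ∀ α, comp (inv α) α = idm (r α)
  lact : V → M → M
  ract : M → V → M
  mul_lact : ∀ x y α, lact (x * y) α = lact x (lact y α)
  ract_mul : ∀ α x y, ract α (x * y) = ract (ract α x) y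
  lact_ract : ∀ x α y, ract (lact x α) y = lact x (ract α y)
  one_lact : ∀ α, lact 1 α = α
  ract_one : ∀ α, ract α 1 = α
  d_lact : ∀ x α, d (lact x α) = x * d α
  r_lact : ∀ x α, r (lact x α) = x * r α
  d_ract : ∀ α x, d (ract α x) = d α * x
  r_ract : ∀ α x, r (ract α x) = r α * x
  lact_comp : ∀ x {α β}, r α = d β → lact x (comp α β) = comp (lact x α) (lact x β)
  ract_comp : ∀ {α β} x, r α = d β → ract (comp α β) x = comp (ract α x) (ract β x)
  lact_idm : ∀ x y, lact x (idm y) = idm (x * y)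
  ract_idm : ∀ x y, ract (idm x) y = idm (x * y)

variable {V M : Type*}

/-- The operation `α * β = (α ◁ βd) ∘ (αr ▷ β)`. -/
def SemiregularGroupoid.star [Monoid V] (G : SemiregularGroupoid V M) (α β : M) : M :=
  G.comp (G.ract α (G.d β)) (G.lact (G.r α) β)

/-- The operation `α ⊛ β = (αd ▷ β) ∘ (α ◁ βr)`. -/
def SemiregularGroupoid.cstar [Monoid V] (G : SemiregularGroupoid V M) (α β : M) : M :=
  G.comp (G.lact (G.d α) β) (G.ract α (G.r β))

/-- In a semiregular groupoid, each of the total operations `*` and `⊛` on the set of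
morphisms is associative with two-sided identity `1_e` (the identity morphism at the
monoid identity `e = 1` of the vertex monoid): each makes the morphisms a monoid. -/
theorem stmt_11 [Monoid V] (G : SemiregularGroupoid V M) :
    (∀ α β γ : M, G.star (G.star α β) γ = G.star α (G.star β γ)) ∧
    (∀ α : M, G.star (G.idm 1) α = α) ∧
    (∀ α : M, G.star α (G.idm 1) = α) ∧
    (∀ α β γ : M, G.cstar (G.cstar α β) γ = G.cstar α (G.cstar β γ)) ∧
    (∀ α : M, G.cstar (G.idm 1) α = α) ∧
    (∀ α : M, G.cstar α (G.idm 1) = α) := by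
  have d1 : ∀ α β, G.r (G.ract α (G.d β)) = G.d (G.lact (G.r α) β) := fun α β => by
    rw [G.r_ract, G.d_lact]
  have d2 : ∀ α β, G.r (G.lact (G.d α) β) = G.d (G.ract α (G.r β)) := fun α β => by
    rw [G.r_lact, G.d_ract]
  refine ⟨fun α β γ => ?_, fun α => ?_, fun α => ?_, fun α β γ => ?_, fun α => ?_, fun α => ?_⟩
  · unfold SemiregularGroupoid.star
    rw [G.r_comp (d1 α β), G.d_comp (d1 β γ), G.ract_comp _ (d1 α β), G.lact_comp _ (d1 β γ),
      G.r_lact, G.d_ract, G.ract_mul, G.mul_lact, G.lact_ract, G.comp_assoc]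
    · simp only [G.r_ract, G.d_lact, G.d_ract, mul_assoc]
    · simp only [G.r_ract, G.r_lact, G.d_lact, mul_assoc]
  · unfold SemiregularGroupoid.star
    rw [G.ract_idm, G.r_idm, G.one_lact, one_mul, G.idm_comp]
  · unfold SemiregularGroupoid.star
    rw [G.lact_idm, G.d_idm, G.ract_one, mul_one, G.comp_idm]
  · unfold SemiregularGroupoid.cstar
    rw [G.d_comp (d2 α β), G.r_comp (d2 β γ), G.ract_comp _ (d2 α β), G.lact_comp _ (d2 β γ),
      G.d_lact, G.r_ract, G.ract_mul, G.mul_lact, G.lact_ract, G.comp_assoc]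
    · simp only [G.r_lact, G.d_lact, G.d_ract]
    · simp only [G.r_ract, G.r_lact, G.d_ract, mul_assoc]
  · unfold SemiregularGroupoid.cstar
    rw [G.ract_idm, G.d_idm, G.one_lact, one_mul, G.comp_idm]
  · unfold SemiregularGroupoid.cstar
    rw [G.lact_idm, G.r_idm, G.ract_one, mul_one, G.idm_comp]
end

section
/- Let G be a semiregular groupoid with vertex monoid V(G), and define α * β = (α ◁ βd) ∘ (αr ▷ β) and α ⊛ β = (αd ▷ β) ∘ (α ◁ βr) on morphisms. Then the operation * satisfies the interchange law with groupoid composition — that is, (α ∘ β) * (γ ∘ δ) = (α * γ) ∘ (β * δ) whenever the composites α ∘ β and γ ∘ δ are defined (equivalently, * together with the monoid structure on V(G) makes G a strict monoidal groupoid) — if and only if the operations * and ⊛ coincide on all morphisms of G. -/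
variable {V M : Type*}

/-- In a semiregular groupoid, the operation `*` satisfies the interchange law with the
groupoid composition (equivalently, `*` and the vertex monoid make `G` a strict monoidal
groupoid) if and only if the operations `*` and `⊛` coincide on all morphisms. -/
theorem stmt_12 [Monoid V] (G : SemiregularGroupoid V M) :
    (∀ α β γ δ : M, G.r α = G.d β → G.r γ = G.d δ →
      G.star (G.comp α β) (G.comp γ δ) = G.comp (G.star α γ) (G.star β δ)) ↔
    (∀ α β : M, G.star α β = G.cstar α β) := by
  constructor
  · intro h α β
    have h1 := h (G.idm (G.d α)) α β (G.idm (G.r β)) (by rw [G.r_idm]) (by rw [G.d_idm])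
    rw [G.idm_comp, G.comp_idm] at h1
    have e1 : G.star (G.idm (G.d α)) β = G.lact (G.d α) β := by
      unfold SemiregularGroupoid.star
      rw [G.ract_idm, G.r_idm, ← G.d_lact, G.idm_comp]
    have e2 : G.star α (G.idm (G.r β)) = G.ract α (G.r β) := by
      unfold SemiregularGroupoid.star
      rw [G.lact_idm, G.d_idm, ← G.r_ract, G.comp_idm]
    rw [h1, e1, e2]
    rfl
  · intro h α β γ δ hab hcd
    have hm := h β γ
    unfold SemiregularGroupoid.star SemiregularGroupoid.cstar at *
    rw [G.d_comp hcd, G.r_comp hab, G.ract_comp _ hab, G.lact_comp _ hcd]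
    have a1 : G.r (G.ract α (G.d γ)) = G.d (G.ract β (G.d γ)) := by
      rw [G.r_ract, G.d_ract, hab]
    have a2 : G.r (G.ract β (G.d γ)) = G.d (G.lact (G.r β) γ) := by
      rw [G.r_ract, G.d_lact]
    have a3 : G.r (G.lact (G.r β) γ) = G.d (G.lact (G.r β) δ) := by
      rw [G.r_lact, G.d_lact, hcd]
    have b1 : G.r (G.ract α (G.d γ)) = G.d (G.lact (G.r α) γ) := by
      rw [G.r_ract, G.d_lact]
    have b2 : G.r (G.lact (G.r α) γ) = G.d (G.ract β (G.d δ)) := by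
      rw [G.r_lact, G.d_ract, hab, hcd]
    have b3 : G.r (G.ract β (G.d δ)) = G.d (G.lact (G.r β) δ) := by
      rw [G.r_ract, G.d_lact]
    rw [G.comp_assoc a1 (by rw [G.d_comp a3]; exact a2), ← G.comp_assoc a2 a3, hm,
      G.comp_assoc b1 (by rw [G.d_comp b3]; exact b2), ← G.comp_assoc b2 b3, hab, hcd]
end

section
/- Let G be a regular groupoid, i.e. a semiregular groupoid whose vertex monoid V(G) is a group. Then the set of all morphisms of G is a group under the operation α * β = (α ◁ βd) ∘ (αr ▷ β), with identity 1_e and with the inverse of α given by α^* = (αr)⁻¹ ▷ α° ◁ (αd)⁻¹, where α° is the groupoid inverse of α; likewise it is a group under α ⊛ β = (αd ▷ β) ∘ (α ◁ βr), with identity 1_e and inverse α^⊛ = (αd)⁻¹ ▷ α° ◁ (αr)⁻¹. -/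
variable {V M : Type*}

/-- The `*`-inverse `α^* = (αr)⁻¹ ▷ α° ◁ (αd)⁻¹` in a regular groupoid. -/
def SemiregularGroupoid.starInv [Group V] (G : SemiregularGroupoid V M) (α : M) : M :=
  G.lact (G.r α)⁻¹ (G.ract (G.inv α) (G.d α)⁻¹)

/-- The `⊛`-inverse `α^⊛ = (αd)⁻¹ ▷ α° ◁ (αr)⁻¹` in a regular groupoid. -/
def SemiregularGroupoid.cstarInv [Group V] (G : SemiregularGroupoid V M) (α : M) : M :=
  G.lact (G.d α)⁻¹ (G.ract (G.inv α) (G.r α)⁻¹)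

/-- In a regular groupoid (a semiregular groupoid whose vertex monoid is a group), the set
of all morphisms is a group under `*`, with identity `1_e` and inverse
`α^* = (αr)⁻¹ ▷ α° ◁ (αd)⁻¹`; likewise it is a group under `⊛` with identity `1_e` and
inverse `α^⊛ = (αd)⁻¹ ▷ α° ◁ (αr)⁻¹`. -/
theorem stmt_13 [Group V] (G : SemiregularGroupoid V M) :
    (∀ α β γ : M, G.star (G.star α β) γ = G.star α (G.star β γ)) ∧
    (∀ α : M, G.star (G.idm 1) α = α) ∧
    (∀ α : M, G.star α (G.idm 1) = α) ∧
    (∀ α : M, G.star α (G.starInv α) = G.idm 1) ∧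
    (∀ α : M, G.star (G.starInv α) α = G.idm 1) ∧
    (∀ α β γ : M, G.cstar (G.cstar α β) γ = G.cstar α (G.cstar β γ)) ∧
    (∀ α : M, G.cstar (G.idm 1) α = α) ∧
    (∀ α : M, G.cstar α (G.idm 1) = α) ∧
    (∀ α : M, G.cstar α (G.cstarInv α) = G.idm 1) ∧
    (∀ α : M, G.cstar (G.cstarInv α) α = G.idm 1) := by
  have h1 : ∀ α β : M, G.r (G.ract α (G.d β)) = G.d (G.lact (G.r α) β) := fun α β => by
    rw [G.r_ract, G.d_lact]
  have h2 : ∀ α β : M, G.r (G.lact (G.d α) β) = G.d (G.ract α (G.r β)) := fun α β => by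
    rw [G.d_ract, G.r_lact]
  have ds : ∀ α β : M, G.d (G.star α β) = G.d α * G.d β := fun α β => by
    rw [SemiregularGroupoid.star, G.d_comp (h1 α β), G.d_ract]
  have rs : ∀ α β : M, G.r (G.star α β) = G.r α * G.r β := fun α β => by
    rw [SemiregularGroupoid.star, G.r_comp (h1 α β), G.r_lact]
  have dc : ∀ α β : M, G.d (G.cstar α β) = G.d α * G.d β := fun α β => by
    rw [SemiregularGroupoid.cstar, G.d_comp (h2 α β), G.d_lact]
  have rc : ∀ α β : M, G.r (G.cstar α β) = G.r α * G.r β := fun α β => by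
    rw [SemiregularGroupoid.cstar, G.r_comp (h2 α β), G.r_ract]
  have dsi : ∀ α : M, G.d (G.starInv α) = (G.d α)⁻¹ := fun α => by
    simp [SemiregularGroupoid.starInv, G.d_lact, G.d_ract, G.d_inv]
  have rsi : ∀ α : M, G.r (G.starInv α) = (G.r α)⁻¹ := fun α => by
    simp [SemiregularGroupoid.starInv, G.r_lact, G.r_ract, G.r_inv]
  have dci : ∀ α : M, G.d (G.cstarInv α) = (G.d α)⁻¹ := fun α => by
    simp [SemiregularGroupoid.cstarInv, G.d_lact, G.d_ract, G.d_inv]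
  have rci : ∀ α : M, G.r (G.cstarInv α) = (G.r α)⁻¹ := fun α => by
    simp [SemiregularGroupoid.cstarInv, G.r_lact, G.r_ract, G.r_inv]
  refine ⟨fun α β γ => ?_, fun α => ?_, fun α => ?_, fun α => ?_, fun α => ?_,
    fun α β γ => ?_, fun α => ?_, fun α => ?_, fun α => ?_, fun α => ?_⟩
  · rw [SemiregularGroupoid.star, rs, SemiregularGroupoid.star.eq_def G α (G.star β γ), ds]
    rw [SemiregularGroupoid.star, SemiregularGroupoid.star, G.ract_comp _ (h1 α β),
      G.lact_comp _ (h1 β γ), G.comp_assoc, G.ract_mul, G.mul_lact, G.lact_ract]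
    all_goals simp [G.r_ract, G.d_ract, G.r_lact, G.d_lact, mul_assoc]
  · rw [SemiregularGroupoid.star, G.ract_idm, G.r_idm, G.one_lact, one_mul, G.idm_comp]
  · rw [SemiregularGroupoid.star, G.lact_idm, G.d_idm, G.ract_one, mul_one, G.comp_idm]
  · rw [SemiregularGroupoid.star, dsi, SemiregularGroupoid.starInv, ← G.mul_lact,
      mul_inv_cancel, G.one_lact, ← G.ract_comp _ (G.d_inv α).symm, G.comp_inv, G.ract_idm,
      mul_inv_cancel]
  · rw [SemiregularGroupoid.star, rsi, SemiregularGroupoid.starInv, G.lact_ract, ← G.ract_mul,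
      inv_mul_cancel, G.ract_one, ← G.lact_comp _ (G.r_inv α), G.inv_comp, G.lact_idm,
      inv_mul_cancel]
  · rw [SemiregularGroupoid.cstar, dc, SemiregularGroupoid.cstar.eq_def G α (G.cstar β γ), rc]
    rw [SemiregularGroupoid.cstar, SemiregularGroupoid.cstar, G.ract_comp _ (h2 α β),
      G.lact_comp _ (h2 β γ), G.comp_assoc, G.ract_mul, G.mul_lact, G.lact_ract]
    all_goals simp [G.r_ract, G.d_ract, G.r_lact, G.d_lact, mul_assoc]
  · rw [SemiregularGroupoid.cstar, G.ract_idm, G.d_idm, G.one_lact, one_mul, G.comp_idm]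
  · rw [SemiregularGroupoid.cstar, G.lact_idm, G.r_idm, G.ract_one, mul_one, G.idm_comp]
  · rw [SemiregularGroupoid.cstar, rci, SemiregularGroupoid.cstarInv, ← G.mul_lact,
      mul_inv_cancel, G.one_lact, ← G.ract_comp _ (G.r_inv α), G.inv_comp, G.ract_idm,
      mul_inv_cancel]
  · rw [SemiregularGroupoid.cstar, dci, SemiregularGroupoid.cstarInv, G.lact_ract, ← G.ract_mul,
      inv_mul_cancel, G.ract_one, ← G.lact_comp _ (G.d_inv α).symm, G.comp_inv, G.lact_idm,
      inv_mul_cancel]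
end

section
/- Let G be a regular groupoid with vertex group V(G). For a morphism α and q ∈ V(G) define α^q = q⁻¹ ▷ α ◁ q. Then this defines a right action of the group V(G) on the group (G, *) of all morphisms under α * β = (α ◁ βd) ∘ (αr ▷ β) by group automorphisms: (α * β)^q = α^q * β^q, (α^q)^{q'} = α^{q q'}, and α^e = α, for all morphisms α, β and all q, q' ∈ V(G). -/
variable {V M : Type*}

/-- The conjugation action `α^q = q⁻¹ ▷ α ◁ q` of the vertex group on morphisms. -/
def SemiregularGroupoid.conj [Group V] (G : SemiregularGroupoid V M) (α : M) (q : V) : M :=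
  G.lact q⁻¹ (G.ract α q)

/-- In a regular groupoid, `α^q = q⁻¹ ▷ α ◁ q` defines a right action of the vertex group
`V(G)` on the group `(G,*)` of all morphisms by group automorphisms. -/
theorem stmt_15 [Group V] (G : SemiregularGroupoid V M) :
    (∀ (α β : M) (q : V), G.conj (G.star α β) q = G.star (G.conj α q) (G.conj β q)) ∧
    (∀ (α : M) (q q' : V), G.conj (G.conj α q) q' = G.conj α (q * q')) ∧
    (∀ α : M, G.conj α 1 = α) := by
  refine ⟨fun α β q => ?_, fun α q q' => ?_, fun α => ?_⟩
  · unfold SemiregularGroupoid.conj SemiregularGroupoid.star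
    have h : G.r (G.ract α (G.d β)) = G.d (G.lact (G.r α) β) := by
      rw [G.r_ract, G.d_lact]
    have h2 : G.r (G.ract (G.ract α (G.d β)) q) = G.d (G.ract (G.lact (G.r α) β) q) := by
      rw [G.r_ract, G.d_ract, h]
    rw [G.ract_comp q h, G.lact_comp _ h2]
    simp only [G.d_lact, G.d_ract, G.r_lact, G.r_ract, G.lact_ract, ← G.ract_mul, ← G.mul_lact]
    congr 2 <;> group
  · unfold SemiregularGroupoid.conj
    rw [G.lact_ract, ← G.mul_lact, ← G.ract_mul, mul_inv_rev]
  · unfold SemiregularGroupoid.conj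
    rw [inv_one, G.one_lact, G.ract_one]
end

section
/- Let G be a regular groupoid with vertex group V(G) and identity e, let star_e(G) = { α : αd = e } with the group operation α * β = (α ◁ βd) ∘ (αr ▷ β), let V(G) act on star_e(G) by α^q = q⁻¹ ▷ α ◁ q, and let r : star_e(G) → V(G) be the range map. Then r together with this action is a crossed module — i.e. r(α^q) = q⁻¹·r(α)·q for all α ∈ star_e(G), q ∈ V(G), and the Peiffer identity α^{r(β)} = β^* * α * β holds for all α, β ∈ star_e(G) (where β^* is the *-inverse of β) — if and only if G is monoidal, i.e. the operations α * β and α ⊛ β = (αd ▷ β) ∘ (α ◁ βr) coincide on all morphisms of G. -/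
variable {V M : Type*}

namespace SemiregularGroupoid

theorem star_lact [Group V] (G : SemiregularGroupoid V M) (x : V) (α β : M) :
    G.star (G.lact x α) β = G.lact x (G.star α β) := by
  unfold star
  rw [G.lact_comp x (by rw [G.r_ract, G.d_lact]), G.lact_ract, G.r_lact, G.mul_lact]

theorem cstar_lact [Group V] (G : SemiregularGroupoid V M) (x : V) (α β : M) :
    G.cstar (G.lact x α) β = G.lact x (G.cstar α β) := by
  unfold cstar
  rw [G.lact_comp x (by rw [G.d_ract, G.r_lact]), G.lact_ract, G.d_lact, G.mul_lact]

theorem star_ract [Group V] (G : SemiregularGroupoid V M) (α β : M) (y : V) :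
    G.star α (G.ract β y) = G.ract (G.star α β) y := by
  unfold star
  rw [G.ract_comp y (by rw [G.r_ract, G.d_lact]), G.lact_ract, G.d_ract, G.ract_mul]

theorem cstar_ract [Group V] (G : SemiregularGroupoid V M) (α β : M) (y : V) :
    G.cstar α (G.ract β y) = G.ract (G.cstar α β) y := by
  unfold cstar
  rw [G.ract_comp y (by rw [G.d_ract, G.r_lact]), G.lact_ract, G.r_ract, G.ract_mul]

theorem comp_inv_cancel [Group V] (G : SemiregularGroupoid V M) (β γ : M)
    (h : G.d β = G.d γ) : G.comp β (G.comp (G.inv β) γ) = γ := by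
  rw [← G.comp_assoc (G.d_inv β).symm ((G.r_inv β).trans h), G.comp_inv, h, G.idm_comp]

theorem inv_comp_cancel [Group V] (G : SemiregularGroupoid V M) (β γ : M)
    (h : G.r β = G.d γ) : G.comp (G.inv β) (G.comp β γ) = γ := by
  rw [← G.comp_assoc (G.r_inv β) h, G.inv_comp, h, G.idm_comp]

theorem lact_inv_cancel [Group V] (G : SemiregularGroupoid V M) (x : V) (α : M) :
    G.lact x (G.lact x⁻¹ α) = α := by
  rw [← G.mul_lact, mul_inv_cancel, G.one_lact]

theorem ract_inv_cancel [Group V] (G : SemiregularGroupoid V M) (x : V) (α : M) :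
    G.ract (G.ract α x⁻¹) x = α := by
  rw [← G.ract_mul, inv_mul_cancel, G.ract_one]

theorem peiffer_rhs [Group V] (G : SemiregularGroupoid V M) (α β : M)
    (hα : G.d α = 1) (hβ : G.d β = 1) :
    G.star (G.star (G.starInv β) α) β
      = G.lact (G.r β)⁻¹ (G.comp (G.inv β) (G.star α β)) := by
  have h1 : G.starInv β = G.lact (G.r β)⁻¹ (G.inv β) := by
    unfold starInv
    rw [hβ, inv_one, G.ract_one]
  have h2 : G.star (G.inv β) α = G.comp (G.inv β) α := by
    unfold star
    rw [hα, G.ract_one, G.r_inv, hβ, G.one_lact]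
  have hc : G.r (G.inv β) = G.d α := by rw [G.r_inv, hα, hβ]
  rw [h1, star_lact, star_lact, h2]
  congr 1
  unfold star
  rw [hβ, G.ract_one, G.ract_one, G.r_comp hc, G.comp_assoc hc]
  rw [G.d_lact, hβ, mul_one]

theorem peiffer_iff [Group V] (G : SemiregularGroupoid V M) (α β : M)
    (hα : G.d α = 1) (hβ : G.d β = 1) :
    G.conj α (G.r β) = G.star (G.star (G.starInv β) α) β ↔ G.star α β = G.cstar α β := by
  have hcs : G.cstar α β = G.comp β (G.ract α (G.r β)) := by
    unfold cstar
    rw [hα, G.one_lact]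
  have hd : G.d (G.star α β) = 1 := by
    unfold star
    rw [G.d_comp (by rw [G.r_ract, G.d_lact]), G.d_ract, hα, hβ, one_mul]
  have hr : G.r β = G.d (G.ract α (G.r β)) := by rw [G.d_ract, hα, one_mul]
  rw [G.peiffer_rhs α β hα hβ, hcs]
  unfold conj
  constructor
  · intro h
    have h' := congrArg (G.lact (G.r β)) h
    rw [G.lact_inv_cancel, G.lact_inv_cancel] at h'
    rw [h', G.comp_inv_cancel _ _ (hβ.trans hd.symm)]
  · intro h
    rw [h, G.inv_comp_cancel _ _ hr]

end SemiregularGroupoid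

/-- In a regular groupoid `G`, the range map `r : star_e(G) → V(G)`, together with the
conjugation action `α^q = q⁻¹ ▷ α ◁ q`, is a crossed module (equivariance plus the Peiffer
identity `α^{rβ} = β^* * α * β` on `star_e(G)`) if and only if `G` is monoidal, i.e. the
operations `*` and `⊛` coincide on all morphisms. -/
theorem stmt_16 [Group V] (G : SemiregularGroupoid V M) :
    ((∀ α : M, G.d α = 1 → ∀ q : V, G.r (G.conj α q) = q⁻¹ * G.r α * q) ∧
     (∀ α β : M, G.d α = 1 → G.d β = 1 →
        G.conj α (G.r β) = G.star (G.star (G.starInv β) α) β)) ↔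
    (∀ α β : M, G.star α β = G.cstar α β) := by
  constructor
  · rintro ⟨-, h⟩ α β
    have hα : G.d (G.lact (G.d α)⁻¹ α) = 1 := by rw [G.d_lact, inv_mul_cancel]
    have hβ : G.d (G.ract β (G.d β)⁻¹) = 1 := by rw [G.d_ract, mul_inv_cancel]
    have key := (G.peiffer_iff _ _ hα hβ).1 (h _ _ hα hβ)
    rw [G.star_lact, G.star_ract, G.cstar_lact, G.cstar_ract] at key
    have k2 := congrArg (fun m => G.ract (G.lact (G.d α) m) (G.d β)) key
    simpa only [G.lact_inv_cancel, G.ract_inv_cancel] using k2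
  · intro h
    refine ⟨fun α _ q => ?_, fun α β hα hβ => (G.peiffer_iff α β hα hβ).2 (h α β)⟩
    unfold SemiregularGroupoid.conj
    rw [G.r_lact, G.r_ract, mul_assoc]
end

section
/- Let X be a set with free group F(X), let 𝓡 be a set equipped with functions ℓ, 𝔯 : 𝓡 → F(X) (recording the reduced images of the left and right sides of each relation), and set ω(q) = ℓ(q)⁻¹·𝔯(q) for q ∈ 𝓡. In the free group on the set 𝓡 × F(X), the normal closure of the set of Squier relators { (s,u)⁻¹·(t, v·ℓ(s)·u)·(s,u)·(t, v·𝔯(s)·u)⁻¹ : s, t ∈ 𝓡, u, v ∈ F(X) } equals the Peiffer subgroup P, the normal closure of the Peiffer elements { (t,u)⁻¹·(s,v)⁻¹·(t,u)·(s, v·u⁻¹·ω(t)·u) : s, t ∈ 𝓡, u, v ∈ F(X) }. Consequently the group presented on generators 𝓡 × F(X) by the Squier relations λ_{t, v·ℓ(s)·u} * λ_{s,u} = λ_{s,u} * λ_{t, v·𝔯(s)·u} is isomorphic, by the map sending the generator λ_{t,u} to the class of (t,u), to the free crossed F(X)-module F/P on ω. -/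
/-- The Squier relators `(s,u)⁻¹ (t, v·ℓ(s)·u) (s,u) (t, v·𝔯(s)·u)⁻¹` in the free group on
`𝓡 × F(X)`, recording the 2-cells of the reduced Squier complex (equivalently the Squier
relations `λ_{t,v·ℓ(s)·u} * λ_{s,u} = λ_{s,u} * λ_{t,v·𝔯(s)·u}`). -/
def squierSet {X 𝓡 : Type*} (l r : 𝓡 → FreeGroup X) :
    Set (FreeGroup (𝓡 × FreeGroup X)) :=
  {x | ∃ (s t : 𝓡) (u v : FreeGroup X),
    x = (FreeGroup.of (s, u))⁻¹ * FreeGroup.of (t, v * l s * u) * FreeGroup.of (s, u) *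
      (FreeGroup.of (t, v * r s * u))⁻¹}

/-- For a group presentation with relation maps `ℓ, 𝔯 : 𝓡 → F(X)` and
`ω(q) = ℓ(q)⁻¹·𝔯(q)`, the normal closure of the Squier relators in the free group on
`𝓡 × F(X)` equals the Peiffer subgroup; consequently the group presented on the
generators `𝓡 × F(X)` by the Squier relations is isomorphic to the free crossed
`F(X)`-module `F/P` on `ω`, by the map sending the generator `λ_{t,u}` to the class
of `(t,u)`. -/
theorem stmt_17 {X 𝓡 : Type*} (l r : 𝓡 → FreeGroup X) :
    Subgroup.normalClosure (squierSet l r) =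
      Subgroup.normalClosure (peifferSet fun q => (l q)⁻¹ * r q) ∧
    ∃ e : PresentedGroup (squierSet l r) ≃*
        (FreeGroup (𝓡 × FreeGroup X) ⧸
          Subgroup.normalClosure (peifferSet fun q => (l q)⁻¹ * r q)),
      ∀ (t : 𝓡) (u : FreeGroup X),
        e (PresentedGroup.of (t, u)) = QuotientGroup.mk (FreeGroup.of (t, u)) := by
  have key : Subgroup.normalClosure (squierSet l r) =
      Subgroup.normalClosure (peifferSet fun q => (l q)⁻¹ * r q) := by
    apply le_antisymm
    · apply Subgroup.normalClosure_le_normal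
      rintro x ⟨s, t, u, v, rfl⟩
      have h : peifferElt (fun q => (l q)⁻¹ * r q) s t u (v * l s * u) ∈
          Subgroup.normalClosure (peifferSet fun q => (l q)⁻¹ * r q) :=
        Subgroup.subset_normalClosure ⟨s, t, u, v * l s * u, rfl⟩
      have e : v * l s * u * u⁻¹ * ((l s)⁻¹ * r s) * u = v * r s * u := by group
      simp only [peifferElt, e] at h
      have h2 := inv_mem (Subgroup.normalClosure_normal.mem_comm h)
      simpa [mul_assoc] using h2
    · apply Subgroup.normalClosure_le_normal
      rintro x ⟨s, t, u, v, rfl⟩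
      have h : (FreeGroup.of (s, u))⁻¹ * FreeGroup.of (t, (v * u⁻¹ * (l s)⁻¹) * l s * u) *
          FreeGroup.of (s, u) * (FreeGroup.of (t, (v * u⁻¹ * (l s)⁻¹) * r s * u))⁻¹ ∈
          Subgroup.normalClosure (squierSet l r) :=
        Subgroup.subset_normalClosure ⟨s, t, u, v * u⁻¹ * (l s)⁻¹, rfl⟩
      have e : v * u⁻¹ * (l s)⁻¹ * l s * u = v := by group
      have e' : v * u⁻¹ * ((l s)⁻¹ * r s) * u = v * u⁻¹ * (l s)⁻¹ * r s * u := by group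
      rw [e] at h
      simp only [peifferElt, e', SetLike.mem_coe]
      refine Subgroup.normalClosure_normal.mem_comm ?_
      simpa [mul_assoc] using inv_mem h
  refine ⟨key, QuotientGroup.quotientMulEquivOfEq key, fun t u => rfl⟩
end

section
/- Let Γ be the free group on one generator x, let R be a one-element set {⋆}, and let ω : R → Γ be the trivial map ω(⋆) = 1 (this arises from the presentation ⟨x : x x⁻¹ = 1⟩ of the infinite cyclic group). Then in the free group F on R × Γ the Peiffer subgroup P equals the commutator subgroup of F, the induced boundary ∂ : F/P → Γ is the trivial homomorphism, and F/P is a free abelian group with basis { λ_q : q ∈ ℤ }, where λ_q is the class of (⋆, x^q); moreover the Γ-action satisfies λ_q^x = λ_{q+1}, so that F/P is isomorphic to the group ring ℤ[Γ] as a Γ-module. In particular F/P is free abelian of countably infinite rank. -/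
/-- `Γ` is the free group on one generator `x`. -/
abbrev Gam : Type := FreeGroup Unit

/-- The generator `x` of `Γ`. -/
abbrev xgen : Gam := FreeGroup.of ()

/-- The trivial map `ω : {⋆} → Γ`, arising from the presentation `⟨x : x x⁻¹ = 1⟩`. -/
abbrev omega18 : Unit → Gam := fun _ => 1

/-- The free crossed module `C = F/P` for the presentation `⟨x : x x⁻¹ = 1⟩`. -/
abbrev C18 : Type :=
  FreeGroup (Unit × Gam) ⧸ Subgroup.normalClosure (peifferSet omega18)

/-- The basis elements `λ_q`, the classes of `(⋆, x^q)` for `q ∈ ℤ`. -/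
def lam (q : ℤ) : C18 := QuotientGroup.mk (FreeGroup.of ((), xgen ^ q))

theorem C18_comm (a b : C18) : a * b = b * a := by
  have gen : ∀ p q : Unit × Gam, Commute (QuotientGroup.mk (FreeGroup.of p) : C18)
      (QuotientGroup.mk (FreeGroup.of q)) := by
    rintro ⟨⟨⟩, u⟩ ⟨⟨⟩, v⟩
    have h : peifferElt omega18 () () u v ∈ Subgroup.normalClosure (peifferSet omega18) :=
      Subgroup.subset_normalClosure ⟨(), (), u, v, rfl⟩
    have h2 := (QuotientGroup.eq_one_iff _).2 h
    simp only [peifferElt, omega18, mul_one, inv_mul_cancel_right, QuotientGroup.mk_mul,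
      QuotientGroup.mk_inv] at h2
    rw [← mul_inv_rev, mul_assoc, inv_mul_eq_one] at h2
    exact h2.symm
  have gen2 : ∀ (p : Unit × Gam) (f : FreeGroup (Unit × Gam)),
      Commute (QuotientGroup.mk (FreeGroup.of p) : C18) (QuotientGroup.mk f) := by
    intro p f
    induction f using FreeGroup.induction_on with
    | C1 => exact Commute.one_right _
    | of q => exact gen p q
    | inv_of q h => exact h.inv_right
    | mul x y hx hy => exact hx.mul_right hy
  induction a using QuotientGroup.induction_on with
  | H f =>
  induction b using QuotientGroup.induction_on with
  | H g =>
  change Commute (QuotientGroup.mk f : C18) (QuotientGroup.mk g)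
  induction f using FreeGroup.induction_on with
  | C1 => exact Commute.one_left _
  | of q => exact gen2 q g
  | inv_of q h => exact h.inv_left
  | mul x y hx hy => exact hx.mul_left hy

open scoped commutatorElement in
theorem C18_P : Subgroup.normalClosure (peifferSet omega18)
    = commutator (FreeGroup (Unit × Gam)) := by
  apply le_antisymm
  · apply Subgroup.normalClosure_le_normal
    rintro _ ⟨r, s, u, v, rfl⟩
    have : peifferElt omega18 r s u v
        = ⁅(FreeGroup.of (r, u))⁻¹, (FreeGroup.of (s, v))⁻¹⁆ := by
      simp [peifferElt, commutatorElement_def]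
    rw [this]
    exact Subgroup.commutator_mem_commutator (Subgroup.mem_top _) (Subgroup.mem_top _)
  · rw [commutator_def, Subgroup.commutator_le]
    intro a _ b _
    rw [← QuotientGroup.eq_one_iff]
    change ⁅(QuotientGroup.mk a : C18), (QuotientGroup.mk b : C18)⁆ = 1
    rw [commutatorElement_eq_one_iff_mul_comm]
    exact C18_comm _ _

section
local instance C18_commGroup : CommGroup C18 := { (inferInstance : Group C18) with mul_comm := C18_comm }

noncomputable def fwdF : FreeGroup (Unit × Gam) →* Multiplicative (Gam →₀ ℤ) :=
  FreeGroup.lift fun p => Multiplicative.ofAdd (Finsupp.single p.2 1)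

noncomputable def fwd : C18 →* Multiplicative (Gam →₀ ℤ) :=
  QuotientGroup.lift _ fwdF (by
    rw [C18_P]
    exact Abelianization.commutator_subset_ker fwdF)

theorem fwd_of (p : Unit × Gam) : fwd (QuotientGroup.mk (FreeGroup.of p))
    = Multiplicative.ofAdd (Finsupp.single p.2 1) := by
  change fwdF (FreeGroup.of p) = _
  simp [fwdF]

noncomputable def bwdA : (Gam →₀ ℤ) →+ Additive C18 :=
  Finsupp.liftAddHom fun u => zmultiplesHom (Additive C18)
    (Additive.ofMul (QuotientGroup.mk (FreeGroup.of ((), u)) : C18))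

noncomputable def bwd : Multiplicative (Gam →₀ ℤ) →* C18 := AddMonoidHom.toMultiplicativeLeft bwdA

theorem bwd_single (u : Gam) : bwd (Multiplicative.ofAdd (Finsupp.single u 1))
    = QuotientGroup.mk (FreeGroup.of ((), u)) := by
  change (bwdA (Finsupp.single u 1)).toMul = _
  simp [bwdA]

theorem bwd_fwd : bwd.comp fwd = MonoidHom.id C18 := by
  apply QuotientGroup.monoidHom_ext
  apply FreeGroup.ext_hom
  rintro ⟨⟨⟩, u⟩
  change bwd (fwd (QuotientGroup.mk (FreeGroup.of ((), u)))) = QuotientGroup.mk (FreeGroup.of ((), u))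
  rw [fwd_of, bwd_single]

theorem fwd_bwd : fwd.comp bwd = MonoidHom.id _ := by
  apply MonoidHom.toAdditive.injective
  apply Finsupp.addHom_ext'
  intro u
  apply AddMonoidHom.ext_int
  change fwd (bwd (Multiplicative.ofAdd (Finsupp.single u 1)))
    = Multiplicative.ofAdd (Finsupp.single u 1)
  rw [bwd_single, fwd_of]

end

noncomputable def eG : C18 ≃* Multiplicative (Gam →₀ ℤ) :=
  MonoidHom.toMulEquiv fwd bwd bwd_fwd fwd_bwd

theorem eG_of (u : Gam) : eG (QuotientGroup.mk (FreeGroup.of ((), u)))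
    = Multiplicative.ofAdd (Finsupp.single u 1) := fwd_of _

theorem eG_act (f : FreeGroup (Unit × Gam)) (g : Gam) :
    fwdF (gammaAct g f) = Multiplicative.ofAdd
      (Finsupp.mapDomain (· * g) (Multiplicative.toAdd (fwdF f))) := by
  have : fwdF.comp (gammaAct g) = (AddMonoidHom.toMultiplicative
      (Finsupp.mapDomain.addMonoidHom (M := ℤ) (fun x : Gam => x * g))).comp fwdF := by
    apply FreeGroup.ext_hom
    rintro ⟨⟨⟩, u⟩
    simp [fwdF, gammaAct, Finsupp.mapDomain_single]
  exact DFunLike.congr_fun this f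

/-- For the presentation `⟨x : x x⁻¹ = 1⟩` of the infinite cyclic group (`Γ = F(x)`,
`R = {⋆}`, `ω(⋆) = 1`): the Peiffer subgroup `P` equals the commutator subgroup of `F`;
the induced boundary `∂ : F/P → Γ` is trivial; `F/P` is free abelian with basis
`{λ_q : q ∈ ℤ}` (hence of countably infinite rank), where `λ_q` is the class of `(⋆,x^q)`;
the `Γ`-action satisfies `λ_q^x = λ_{q+1}`; and `F/P` is isomorphic to the group ring
`ℤ[Γ]` as a `Γ`-module. -/
theorem stmt_18
    (bd : C18 →* Gam)
    (hbd : ∀ p : Unit × Gam,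
      bd (QuotientGroup.mk (FreeGroup.of p)) = p.2⁻¹ * omega18 p.1 * p.2)
    (act : C18 → Gam → C18)
    (hact : ∀ (f : FreeGroup (Unit × Gam)) (v : Gam),
      act (QuotientGroup.mk f) v = QuotientGroup.mk (gammaAct v f)) :
    Subgroup.normalClosure (peifferSet omega18) = commutator (FreeGroup (Unit × Gam)) ∧
    bd = 1 ∧
    (∃ e : C18 ≃* Multiplicative (ℤ →₀ ℤ),
      ∀ q : ℤ, e (lam q) = Multiplicative.ofAdd (Finsupp.single q 1)) ∧
    (∀ q : ℤ, act (lam q) xgen = lam (q + 1)) ∧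
    (∃ e : C18 ≃* Multiplicative (Gam →₀ ℤ),
      (∀ u : Gam, e (QuotientGroup.mk (FreeGroup.of ((), u))) =
        Multiplicative.ofAdd (Finsupp.single u 1)) ∧
      ∀ (c : C18) (g : Gam),
        e (act c g) = Multiplicative.ofAdd
          (Finsupp.mapDomain (· * g) (Multiplicative.toAdd (e c)))) := by
  refine ⟨C18_P, ?_, ?_, ?_, eG, eG_of, ?_⟩
  · apply QuotientGroup.monoidHom_ext
    apply FreeGroup.ext_hom
    intro p
    change bd (QuotientGroup.mk (FreeGroup.of p)) = 1
    rw [hbd]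
    simp
  · refine ⟨eG.trans (AddEquiv.toMultiplicative
      (Finsupp.domCongr FreeGroup.freeGroupUnitEquivInt)), fun q => ?_⟩
    have h : FreeGroup.freeGroupUnitEquivInt (xgen ^ q) = q :=
      FreeGroup.freeGroupUnitEquivInt.apply_symm_apply q
    rw [MulEquiv.trans_apply, lam, eG_of]
    change Multiplicative.ofAdd (Finsupp.equivMapDomain FreeGroup.freeGroupUnitEquivInt
      (Finsupp.single (xgen ^ q) 1)) = _
    rw [Finsupp.equivMapDomain_single, h]
  · intro q
    rw [lam, hact, lam]
    simp [gammaAct, zpow_add_one]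
  · intro c g
    induction c using QuotientGroup.induction_on with
    | H f =>
    rw [hact]
    exact eG_act f g
end
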